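/- Let H be a real inner product space, σ > 0, and let Ψ : ℝ^p → H satisfy ⟨Ψ(y), Ψ(z)⟩_H = exp(−‖y − z‖^2/(2σ^2)) for all y, z ∈ ℝ^p (a feature map of the Gaussian kernel). Let y_1, …, y_m ∈ ℝ^p and g ∈ ℝ^m, and suppose there exists z_0 ∈ ℝ^p with Σ_{i=1}^m g_i exp(−‖y_i − z_0‖^2/(2σ^2)) > 0. Then the function z ↦ ‖Σ_{i=1}^m g_i Ψ(y_i) − Ψ(z)‖_H^2 attains its infimum over ℝ^p. -/

import Mathlib

open RealInnerProductSpace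

/-- For a feature map `Ψ` of the Gaussian kernel (`⟪Ψ y, Ψ z⟫ = exp(−‖y−z‖²/(2σ²))`),
if `Σᵢ gᵢ exp(−‖yᵢ − z₀‖²/(2σ²)) > 0` for some `z₀`, then `z ↦ ‖Σᵢ gᵢ Ψ(yᵢ) − Ψ z‖²`
attains its infimum over `ℝ^p`. -/
theorem stmt10 {p m : ℕ} {H : Type*} [NormedAddCommGroup H] [InnerProductSpace ℝ H]
    (σ : ℝ) (hσ : 0 < σ) (Ψ : EuclideanSpace ℝ (Fin p) → H)
    (hker : ∀ y z : EuclideanSpace ℝ (Fin p),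
      ⟪Ψ y, Ψ z⟫ = Real.exp (-‖y - z‖ ^ 2 / (2 * σ ^ 2)))
    (y : Fin m → EuclideanSpace ℝ (Fin p)) (g : Fin m → ℝ)
    (z₀ : EuclideanSpace ℝ (Fin p))
    (hpos : 0 < ∑ i, g i * Real.exp (-‖y i - z₀‖ ^ 2 / (2 * σ ^ 2))) :
    ∃ zs : EuclideanSpace ℝ (Fin p), ∀ z : EuclideanSpace ℝ (Fin p),
      ‖(∑ i, g i • Ψ (y i)) - Ψ zs‖ ^ 2 ≤ ‖(∑ i, g i • Ψ (y i)) - Ψ z‖ ^ 2 := by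
  set f : EuclideanSpace ℝ (Fin p) → ℝ :=
    fun z => ∑ i, g i * Real.exp (-‖y i - z‖ ^ 2 / (2 * σ ^ 2)) with hf
  have hcont : Continuous f := by
    rw [hf]
    fun_prop
  have hlim : Filter.Tendsto f (Filter.cocompact _) (nhds 0) := by
    have h0 : (0 : ℝ) = ∑ i : Fin m, g i * 0 := by simp
    rw [h0]
    refine tendsto_finsetSum _ fun i _ => Filter.Tendsto.const_mul _ ?_
    refine Real.tendsto_exp_atBot.comp ?_
    refine Filter.Tendsto.atBot_div_const (by positivity) ?_
    refine Filter.tendsto_neg_atTop_atBot.comp ?_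
    refine (Filter.tendsto_pow_atTop (two_ne_zero)).comp ?_
    have h1 : ∀ z, ‖z‖ - ‖y i‖ ≤ ‖y i - z‖ := fun z => by
      rw [norm_sub_rev]
      exact norm_sub_norm_le z (y i)
    exact Filter.tendsto_atTop_mono h1
      (Filter.tendsto_atTop_add_const_right _ _ (tendsto_norm_cocompact_atTop))
  have hev : ∀ᶠ z in Filter.cocompact _, f z ≤ f z₀ :=
    (hlim.eventually (gt_mem_nhds hpos)).mono fun z hz => le_of_lt hz
  obtain ⟨zs, hzs⟩ := hcont.exists_forall_ge' z₀ hev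
  refine ⟨zs, fun z => ?_⟩
  have hin : ∀ z, ⟪∑ i, g i • Ψ (y i), Ψ z⟫ = f z := fun z => by
    simp only [hf, sum_inner, real_inner_smul_left, hker]
  have hnorm : ∀ z, ‖Ψ z‖ ^ 2 = 1 := fun z => by
    rw [← real_inner_self_eq_norm_sq, hker]
    simp
  rw [norm_sub_sq_real, norm_sub_sq_real, hin, hin, hnorm, hnorm]
  linarith [hzs z]
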